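/- (Matter–gauge duality: 𝒰 = 𝒰̄ on the symmetric subspace.) For φ' ∈ C^{p+1}(G) define the projector P̃(φ') = |G|^{−|Δ^{p+1}|} Σ_{k' ∈ C_{p+1}(Ĝ)} e^{−i⟨k',φ'⟩} Ũ(k'). Let t : B^{p+1}(G) → C^p(G) be a section of the coboundary map, i.e. δ(t(φ')) = φ' for all φ' ∈ B^{p+1}(G), and define 𝒰̄ = Σ_{φ' ∈ B^{p+1}(G)} P̃(φ') U(t(φ')). Then for every vector v ∈ H satisfying U(φ) v = v for all φ ∈ Z^p(G) and Ũ(k') v = v for all k' ∈ Z_{p+1}(Ĝ), one has 𝒰 v = 𝒰̄ v. -/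

import Mathlib

open Finset

set_option linter.unusedSectionVars false

noncomputable section

/-- The Pontryagin dual `Ĝ = Hom(G, ℝ/2πℤ)` of an abelian group `G`,
where `ℝ/2πℤ` is `Real.Angle = AddCircle (2π)`. -/
abbrev PDual (G : Type) [AddCommGroup G] : Type := G →+ Real.Angle

/-- The dual of a finite abelian group is finite (hence all the `∑ᶠ` sums over
(subsets of) chain groups with coefficients in `PDual G` below are honest
finite sums). -/
instance PDual.finite (G : Type) [AddCommGroup G] [Fintype G] : Finite (PDual G) := by
  classical
  set n := Fintype.card G with hn
  have hn0 : 0 < n := Fintype.card_pos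
  haveI : Fact (0 < 2 * Real.pi) := ⟨by positivity⟩
  have hT0 : Set.Finite {θ : AddCircle (2 * Real.pi) | n • θ = 0} := by
    have hU : Set.Finite
        (⋃ d ∈ Finset.Icc 1 n, {θ : AddCircle (2 * Real.pi) | addOrderOf θ = d}) :=
      Set.Finite.biUnion (Finset.Icc 1 n).finite_toSet
        (fun d hd => AddCircle.finite_setOfPred_addOrderOf_eq (2 * Real.pi)
          (by simp only [Finset.coe_Icc, Set.mem_Icc] at hd; exact hd.1))
    refine hU.subset ?_
    intro θ hθ
    have hfin : IsOfFinAddOrder θ := by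
      rw [isOfFinAddOrder_iff_nsmul_eq_zero]
      exact ⟨n, hn0, hθ⟩
    have hdvd : addOrderOf θ ∣ n := addOrderOf_dvd_of_nsmul_eq_zero hθ
    have hpos : 0 < addOrderOf θ := hfin.addOrderOf_pos
    refine Set.mem_iUnion₂.mpr ⟨addOrderOf θ, ?_, rfl⟩
    simp only [Finset.mem_Icc]
    exact ⟨hpos, Nat.le_of_dvd hn0 hdvd⟩
  have hT : Set.Finite {θ : Real.Angle | n • θ = 0} := hT0
  haveI : Finite {θ : Real.Angle | n • θ = 0} := hT.to_subtype
  have hinj : Function.Injective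
      (fun (k : G →+ Real.Angle) (g : G) =>
        (⟨k g, by
          show n • k g = 0
          rw [← map_nsmul, card_nsmul_eq_zero, map_zero]⟩ :
          {θ : Real.Angle | n • θ = 0})) := by
    intro k₁ k₂ h
    ext g
    have := congrFun h g
    simpa [Subtype.ext_iff] using this
  exact Finite.of_injective _ hinj

/-- The well-defined complex exponential `e^{iθ} = cos θ + i sin θ` for `θ ∈ ℝ/2πℤ`. -/
def expA (θ : Real.Angle) : ℂ := Real.Angle.cos θ + Real.Angle.sin θ * Complex.I

variable {G : Type} [AddCommGroup G] [Fintype G]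

/-- The pairing `⟨k, φ⟩ = ∑_{σ ∈ Δ} k(σ)(φ(σ))` with values in `ℝ/2πℤ`. -/
def pairing {Δ : Type} [Fintype Δ] (k : Δ → PDual G) (φ : Δ → G) : Real.Angle :=
  ∑ σ, k σ (φ σ)

/-- The boundary map `∂`, `(∂k')(σ) = ∑_τ s(τ,σ) • k'(τ)`; its image is the
boundary group `B_p(Ĝ)` and its kernel the cycle group `Z_{p+1}(Ĝ)`. -/
def bd {A B : Type} [Fintype A] (s : A → B → ℤ) (k' : A → PDual G) : B → PDual G :=
  fun σ => ∑ τ, s τ σ • k' τ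

/-- The coboundary map `δ`, `(δφ)(τ) = ∑_σ s(τ,σ) • φ(σ)`; its kernel is the
cocycle group `Z^p(G)` and its image the coboundary group `B^{p+1}(G)`. -/
def cb {A B : Type} [Fintype B] (s : A → B → ℤ) (φ : B → G) : A → G :=
  fun τ => ∑ σ, s τ σ • φ σ

variable {H : Type} [NormedAddCommGroup H] [InnerProductSpace ℂ H]
  [FiniteDimensional ℂ H]

/-- The product of a pairwise-commuting finite family of operators. -/
def commProd {ι : Type} [Fintype ι] (f : ι → H →L[ℂ] H)
    (h : ∀ i j, Commute (f i) (f j)) : H →L[ℂ] H :=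
  Finset.univ.noncommProd f (fun a _ b _ _ => h a b)

variable {Δp Δp1 : Type} [Fintype Δp] [Fintype Δp1]

/-- `U(φ) = ∏_{σ ∈ Δ^p} U_σ(φ(σ))`. -/
def Uop (U : Δp → G → H →L[ℂ] H)
    (hU : ∀ σ σ' g g', Commute (U σ g) (U σ' g')) (φ : Δp → G) : H →L[ℂ] H :=
  commProd (fun σ => U σ (φ σ)) fun σ σ' => hU σ σ' _ _

/-- The local factor `|G|⁻¹ ∑_{g ∈ G} e^{−i k(σ)(g)} U_σ(g)` of `P(k)`. -/
def Pfactor (U : Δp → G → H →L[ℂ] H) (k : Δp → PDual G) (σ : Δp) : H →L[ℂ] H :=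
  (Fintype.card G : ℂ)⁻¹ • ∑ g : G, expA (-(k σ g)) • U σ g

theorem Pfactor_commute (U : Δp → G → H →L[ℂ] H)
    (hU : ∀ σ σ' g g', Commute (U σ g) (U σ' g')) (k : Δp → PDual G)
    (σ σ' : Δp) : Commute (Pfactor U k σ) (Pfactor U k σ') := by
  unfold Pfactor
  apply Commute.smul_left
  apply Commute.smul_right
  apply Commute.sum_left
  intro g _
  apply Commute.sum_right
  intro g' _
  exact ((hU σ σ' g g').smul_right _).smul_left _

/-- The projector `P(k) = ∏_{σ ∈ Δ^p} ( |G|⁻¹ ∑_{g ∈ G} e^{−i k(σ)(g)} U_σ(g) )`. -/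
def Pop (U : Δp → G → H →L[ℂ] H)
    (hU : ∀ σ σ' g g', Commute (U σ g) (U σ' g')) (k : Δp → PDual G) : H →L[ℂ] H :=
  commProd (Pfactor U k) (Pfactor_commute U hU k)

/-- `Ũ(k') = ∏_{τ ∈ Δ^{p+1}} Ũ_τ(k'(τ))`. -/
def Utop (Ut : Δp1 → PDual G → H →L[ℂ] H)
    (hUt : ∀ τ τ' ρ ρ', Commute (Ut τ ρ) (Ut τ' ρ')) (k' : Δp1 → PDual G) : H →L[ℂ] H :=
  commProd (fun τ => Ut τ (k' τ)) fun τ τ' => hUt τ τ' _ _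

/-- The minimal coupling operator `𝒰 = ∑_{k ∈ B_p(Ĝ)} P(k) Ũ(r(k))`, for a fixed
section `r` of the boundary map. -/
def MC (s : Δp1 → Δp → ℤ) (U : Δp → G → H →L[ℂ] H)
    (hU : ∀ σ σ' g g', Commute (U σ g) (U σ' g'))
    (Ut : Δp1 → PDual G → H →L[ℂ] H)
    (hUt : ∀ τ τ' ρ ρ', Commute (Ut τ ρ) (Ut τ' ρ'))
    (r : (Δp → PDual G) → (Δp1 → PDual G)) : H →L[ℂ] H :=
  ∑ᶠ k ∈ Set.range (bd (G := G) s), Pop U hU k * Utop Ut hUt (r k)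

/-- The projector `P̃(φ') = |G|^{−|Δ^{p+1}|} ∑_{k' ∈ C_{p+1}(Ĝ)} e^{−i⟨k',φ'⟩} Ũ(k')`. -/
def Ptilde (Ut : Δp1 → PDual G → H →L[ℂ] H)
    (hUt : ∀ τ τ' ρ ρ', Commute (Ut τ ρ) (Ut τ' ρ')) (φ' : Δp1 → G) : H →L[ℂ] H :=
  ((Fintype.card G : ℂ) ^ Fintype.card Δp1)⁻¹ •
    ∑ᶠ k' : Δp1 → PDual G, expA (-(pairing k' φ')) • Utop Ut hUt k'

lemma expA_eq (θ : Real.Angle) : expA θ = (θ.toCircle : ℂ) := (Real.Angle.coe_toCircle θ).symm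

lemma expA_zero : expA 0 = 1 := by simp [expA_eq]

lemma expA_add (a b : Real.Angle) : expA (a + b) = expA a * expA b := by simp [expA_eq]

lemma expA_sum {ι : Type} (S : Finset ι) (f : ι → Real.Angle) :
    expA (∑ i ∈ S, f i) = ∏ i ∈ S, expA (f i) := by
  classical
  induction S using Finset.induction_on with
  | empty => simp [expA_zero]
  | insert a S ha ih => rw [Finset.sum_insert ha, Finset.prod_insert ha, expA_add, ih]

lemma expA_eq_one {θ : Real.Angle} (h : expA θ = 1) : θ = 0 := by
  rw [expA_eq] at h
  have := Real.Angle.arg_toCircle θ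
  rw [h] at this
  simpa using this.symm

open Classical in
lemma charsum {A : Type} [AddCommGroup A] [Fintype A] (f : A →+ Real.Angle) :
    ∑ a, expA (-(f a)) = if (∀ a, f a = 0) then (Fintype.card A : ℂ) else 0 := by
  split_ifs with h
  · simp [h, expA_zero]
  · push Not at h
    obtain ⟨b, hb⟩ := h
    have h1 : ∑ a, expA (-(f a)) = expA (-(f b)) * ∑ a, expA (-(f a)) := by
      rw [Finset.mul_sum]
      rw [← Equiv.sum_comp (Equiv.addLeft b)]
      refine Finset.sum_congr rfl fun a _ => ?_
      rw [← expA_add]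
      simp [add_comm]
    have h2 : expA (-(f b)) ≠ 1 := fun h => hb (by simpa using expA_eq_one h)
    have h3 : (expA (-(f b)) - 1) * ∑ a, expA (-(f a)) = 0 := by
      rw [sub_mul, ← h1, one_mul, sub_self]
    exact (mul_eq_zero.mp h3).resolve_left (sub_ne_zero.mpr h2)

lemma dual_sep (g : G) (hg : g ≠ 0) : ∃ ρ : PDual G, ρ g ≠ 0 := by
  obtain ⟨ψ, hψ⟩ := AddChar.exists_apply_ne_zero.mpr hg
  have hne : ∀ x, ψ x ≠ 0 := fun x h => by
    have := ψ.norm_apply x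
    rw [h] at this
    simp at this
  refine ⟨AddMonoidHom.mk' (fun x => (Complex.arg (ψ x) : Real.Angle)) fun a b => ?_, ?_⟩
  · rw [AddChar.map_add_eq_mul, Complex.arg_mul_coe_angle (hne a) (hne b)]
  · intro h
    apply hψ
    have h' : Complex.arg (ψ g) = 0 := by
      have : (Complex.arg (ψ g) : Real.Angle) = ((0 : ℝ) : Real.Angle) := by simpa using h
      have := congrArg Real.Angle.toReal this
      simpa using this
    rw [← Complex.norm_mul_exp_arg_mul_I (ψ g), h', ψ.norm_apply]
    simp

section pair
variable {D : Type} [Fintype D]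

/-- pairing as a hom in the second variable -/
def pairR (k : D → PDual G) : (D → G) →+ Real.Angle :=
  AddMonoidHom.mk' (fun φ => pairing k φ) fun a b => by
    simp [pairing, Finset.sum_add_distrib]

/-- pairing as a hom in the first variable -/
def pairL (φ : D → G) : (D → PDual G) →+ Real.Angle :=
  AddMonoidHom.mk' (fun k => pairing k φ) fun a b => by
    simp [pairing, Finset.sum_add_distrib]

lemma pairR_zero_iff (k : D → PDual G) : (∀ φ, pairing k φ = 0) ↔ k = 0 := by
  classical
  constructor
  · intro h
    ext d g
    have := h (Pi.single d g)
    rw [pairing, Finset.sum_eq_single d] at this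
    · simpa using this
    · intro b _ hb
      simp [Pi.single_eq_of_ne hb]
    · simp
  · rintro rfl φ
    simp [pairing]

lemma pairL_zero_iff (φ : D → G) : (∀ k : D → PDual G, pairing k φ = 0) ↔ φ = 0 := by
  classical
  constructor
  · intro h
    by_contra hne
    obtain ⟨d, hd⟩ := Function.ne_iff.mp hne
    obtain ⟨ρ, hρ⟩ := dual_sep (φ d) hd
    have := h (Pi.single d ρ)
    rw [pairing, Finset.sum_eq_single d] at this
    · exact hρ (by simpa using this)
    · intro b _ hb
      simp [Pi.single_eq_of_ne hb]
    · simp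
  · rintro rfl k
    simp [pairing]

lemma pairing_adj {E : Type} [Fintype E] (s : E → D → ℤ) (k : E → PDual G) (φ : D → G) :
    pairing (bd s k) φ = pairing k (cb s φ) := by
  simp only [pairing, bd, cb, AddMonoidHom.finsetSum_apply, map_sum, AddMonoidHom.smul_apply,
    map_zsmul]
  rw [Finset.sum_comm]

end pair

lemma card_dual [Fintype (PDual G)] : (Fintype.card (PDual G) : ℂ) = Fintype.card G := by
  classical
  have h1 : ∑ ρ : PDual G, ∑ g : G, expA (-(ρ g)) = (Fintype.card G : ℂ) := by
    simp_rw [charsum]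
    have : ∀ ρ : PDual G, (∀ a, ρ a = 0) ↔ ρ = 0 := fun ρ => by
      rw [DFunLike.ext_iff]; rfl
    simp [this]
  have h2 : ∑ g : G, ∑ ρ : PDual G, expA (-(ρ g)) = (Fintype.card (PDual G) : ℂ) := by
    have h : ∀ g : G, ∑ ρ : PDual G, expA (-(ρ g))
        = if g = 0 then (Fintype.card (PDual G) : ℂ) else 0 := by
      intro g
      have := charsum (AddMonoidHom.eval g : PDual G →+ Real.Angle)
      simp only [AddMonoidHom.eval_apply_apply] at this
      rw [this]
      refine if_congr ⟨fun h => ?_, ?_⟩ rfl rfl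
      · by_contra hg
        obtain ⟨ρ, hρ⟩ := dual_sep g hg
        exact hρ (h ρ)
      · rintro rfl a
        simp
    simp_rw [h]
    simp
  rw [← h1, ← h2, Finset.sum_comm]

/-- `bd` as a hom -/
def bdHom (s : Δp1 → Δp → ℤ) : (Δp1 → PDual G) →+ (Δp → PDual G) :=
  AddMonoidHom.mk' (bd s) fun a b => by
    funext σ
    simp [bd, Finset.sum_add_distrib]

/-- `cb` as a hom -/
def cbHom (s : Δp1 → Δp → ℤ) : (Δp → G) →+ (Δp1 → G) :=
  AddMonoidHom.mk' (cb s) fun a b => by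
    funext σ
    simp [cb, Finset.sum_add_distrib]

lemma sum_fiber {A B M : Type} [AddCommGroup A] [AddCommGroup B] [AddCommGroup M] [Fintype A]
    [DecidableEq B] (f : A →+ B) (F : B → M) :
    ∑ a, F (f a) = #{a | f a = 0} • ∑ᶠ b ∈ Set.range f, F b := by
  classical
  have hr : Set.range f = ((Finset.univ.image f : Finset B) : Set B) := by simp
  rw [Finset.sum_comp, hr, finsum_mem_coe_finset, Finset.smul_sum]
  refine Finset.sum_congr rfl fun b hb => ?_
  congr 1
  refine AddMonoidHom.card_fiber_eq_of_mem_range f (by simpa using hb) ⟨0, by simp⟩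

lemma counting [Fintype (PDual G)] [DecidableEq (Δp → PDual G)] [DecidableEq (Δp1 → G)]
    [Fintype (Δp → G)] [Fintype (Δp1 → PDual G)]
    (s : Δp1 → Δp → ℤ) :
    (Fintype.card G : ℂ) ^ Fintype.card Δp * #{k : Δp1 → PDual G | bd s k = 0}
      = (Fintype.card G : ℂ) ^ Fintype.card Δp1 * #{φ : Δp → G | cb s φ = 0} := by
  classical
  have h1 : ∀ k : Δp1 → PDual G, ∑ φ : Δp → G, expA (-(pairing k (cb s φ)))
      = if bd s k = 0 then (Fintype.card G : ℂ) ^ Fintype.card Δp else 0 := by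
    intro k
    have := charsum (pairR (bd s k))
    simp only [pairR, AddMonoidHom.mk'_apply, pairing_adj] at this
    have hc : Fintype.card (Δp → G) = Fintype.card G ^ Fintype.card Δp := by
      rw [← Nat.card_eq_fintype_card, Nat.card_fun, Nat.card_eq_fintype_card, Nat.card_eq_fintype_card]
    rw [hc] at this
    push_cast at this
    convert! this
    simp only [← pairR_zero_iff, pairing_adj]
  have h2 : ∀ φ : Δp → G, ∑ k : Δp1 → PDual G, expA (-(pairing k (cb s φ)))
      = if cb s φ = 0 then (Fintype.card G : ℂ) ^ Fintype.card Δp1 else 0 := by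
    intro φ
    have := charsum (pairL (cb s φ))
    simp only [pairL, AddMonoidHom.mk'_apply, pairL_zero_iff] at this
    have hc : Fintype.card (Δp1 → PDual G) = Fintype.card (PDual G) ^ Fintype.card Δp1 := by
      rw [← Nat.card_eq_fintype_card, Nat.card_fun, Nat.card_eq_fintype_card, Nat.card_eq_fintype_card]
    rw [hc] at this
    push_cast [card_dual] at this
    convert! this
    exact (pairL_zero_iff (cb s φ)).symm
  have h3 := Finset.sum_comm (s := (Finset.univ : Finset (Δp1 → PDual G)))
    (t := (Finset.univ : Finset (Δp → G))) (f := fun k φ => expA (-(pairing k (cb s φ))))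
  simp_rw [h1, h2] at h3
  rw [← Finset.sum_filter, ← Finset.sum_filter, Finset.sum_const, Finset.sum_const,
    nsmul_eq_mul, nsmul_eq_mul] at h3
  rw [mul_comm, h3, mul_comm]

lemma commProd_mul {ι : Type} [Fintype ι] (f g fg : ι → H →L[ℂ] H) (hf hg hfg)
    (h : ∀ i j, Commute (g i) (f j)) (he : ∀ i, fg i = f i * g i) :
    commProd fg hfg = commProd f hf * commProd g hg := by
  obtain rfl : fg = f * g := funext he
  unfold commProd
  exact Finset.noncommProd_mul_distrib f g _ _ fun a _ b _ _ => h a b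

lemma Uop_add (U : Δp → G → H →L[ℂ] H)
    (hU : ∀ σ σ' g g', Commute (U σ g) (U σ' g'))
    (hUhom : ∀ σ g g', U σ (g + g') = U σ g * U σ g') (φ ψ : Δp → G) :
    Uop U hU (φ + ψ) = Uop U hU φ * Uop U hU ψ :=
  commProd_mul _ _ _ _ _ _ (fun i j => hU _ _ _ _) fun i => hUhom _ _ _

lemma Utop_add (U : Δp1 → PDual G → H →L[ℂ] H)
    (hU : ∀ σ σ' g g', Commute (U σ g) (U σ' g'))
    (hUhom : ∀ σ g g', U σ (g + g') = U σ g * U σ g') (φ ψ : Δp1 → PDual G) :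
    Utop U hU (φ + ψ) = Utop U hU φ * Utop U hU ψ :=
  commProd_mul _ _ _ _ _ _ (fun i j => hU _ _ _ _) fun i => hUhom _ _ _

lemma Uop_Utop_comm (U : Δp → G → H →L[ℂ] H)
    (hU : ∀ σ σ' g g', Commute (U σ g) (U σ' g'))
    (Ut : Δp1 → PDual G → H →L[ℂ] H)
    (hUt : ∀ τ τ' ρ ρ', Commute (Ut τ ρ) (Ut τ' ρ'))
    (hmix : ∀ σ τ g ρ, Commute (U σ g) (Ut τ ρ)) (φ k) :
    Commute (Uop U hU φ) (Utop Ut hUt k) := by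
  unfold Uop Utop commProd
  apply Finset.noncommProd_commute
  intro τ _
  apply Commute.symm
  apply Finset.noncommProd_commute
  intro σ _
  exact (hmix _ _ _ _).symm

lemma Pop_eq [Fintype (Δp → G)] (U : Δp → G → H →L[ℂ] H)
    (hU : ∀ σ σ' g g', Commute (U σ g) (U σ' g')) (k : Δp → PDual G) :
    Pop U hU k = ((Fintype.card G : ℂ) ^ Fintype.card Δp)⁻¹ •
      ∑ φ : Δp → G, expA (-(pairing k φ)) • Uop U hU φ := by
  classical
  let X : Set (H →L[ℂ] H) := Set.range fun p : Δp × G => U p.1 p.2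
  have hX : ∀ a ∈ X, ∀ b ∈ X, a * b = b * a := by
    rintro _ ⟨p, rfl⟩ _ ⟨q, rfl⟩
    exact hU _ _ _ _
  letI : CommRing (Algebra.adjoin ℂ X) := Algebra.adjoinCommRingOfComm ℂ hX
  let u : Δp → G → Algebra.adjoin ℂ X := fun σ g => ⟨U σ g, Algebra.subset_adjoin ⟨(σ, g), rfl⟩⟩
  have key : ∀ (f : Δp → Algebra.adjoin ℂ X) (h),
      commProd (fun σ => (f σ : H →L[ℂ] H)) h = ((∏ σ, f σ : Algebra.adjoin ℂ X) : H →L[ℂ] H) := by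
    intro f h
    unfold commProd
    rw [← Finset.noncommProd_eq_prod]
    exact (Finset.map_noncommProd _ _ _ (Algebra.adjoin ℂ X).val).symm
  have hP : Pop U hU k = ((∏ σ, (Fintype.card G : ℂ)⁻¹ • ∑ g : G, expA (-(k σ g)) • u σ g :
      Algebra.adjoin ℂ X) : H →L[ℂ] H) := by
    rw [← key _ (fun i j => by exact congrArg (Subtype.val : Algebra.adjoin ℂ X → H →L[ℂ] H) (mul_comm _ _))]
    unfold Pop
    congr 1
    funext σ
    simp [Pfactor, u]
  have hUo : ∀ φ, Uop U hU φ = ((∏ σ, u σ (φ σ) : Algebra.adjoin ℂ X) : H →L[ℂ] H) := by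
    intro φ
    rw [← key _ (fun i j => by exact congrArg (Subtype.val : Algebra.adjoin ℂ X → H →L[ℂ] H) (mul_comm _ _))]
    rfl
  have hmain : (∏ σ, (Fintype.card G : ℂ)⁻¹ • ∑ g : G, expA (-(k σ g)) • u σ g)
      = ((Fintype.card G : ℂ) ^ Fintype.card Δp)⁻¹ •
      ∑ φ : Δp → G, expA (-(pairing k φ)) • ∏ σ, u σ (φ σ) := by
    rw [Finset.prod_smul, Finset.prod_const, inv_pow, Finset.card_univ]
    congr 1
    rw [Finset.prod_univ_sum, Fintype.piFinset_univ]
    refine Finset.sum_congr (by ext; simp) fun φ _ => ?_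
    rw [Finset.prod_smul, pairing, ← Finset.sum_neg_distrib, expA_sum]
  rw [hP, hmain]
  simp [hUo]

/-- **Matter–gauge duality** (`𝒰 = 𝒰̄` on the symmetric subspace): with
`𝒰̄ = ∑_{φ' ∈ B^{p+1}(G)} P̃(φ') U(t(φ'))` for a fixed section `t` of the
coboundary map, `𝒰 v = 𝒰̄ v` for every `v` invariant under all `U(φ)`,
`φ ∈ Z^p(G)`, and all `Ũ(k')`, `k' ∈ Z_{p+1}(Ĝ)`. -/
theorem matter_gauge_duality
    (s : Δp1 → Δp → ℤ)
    (U : Δp → G → H →L[ℂ] H)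
    (hU : ∀ σ σ' g g', Commute (U σ g) (U σ' g'))
    (hUhom : ∀ σ g g', U σ (g + g') = U σ g * U σ g')
    (hU0 : ∀ σ, U σ 0 = 1)
    (hUunit : ∀ σ g, star (U σ g) * U σ g = 1 ∧ U σ g * star (U σ g) = 1)
    (Ut : Δp1 → PDual G → H →L[ℂ] H)
    (hUt : ∀ τ τ' ρ ρ', Commute (Ut τ ρ) (Ut τ' ρ'))
    (hUthom : ∀ τ ρ ρ', Ut τ (ρ + ρ') = Ut τ ρ * Ut τ ρ')
    (hUt0 : ∀ τ, Ut τ 0 = 1)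
    (hUtunit : ∀ τ ρ, star (Ut τ ρ) * Ut τ ρ = 1 ∧ Ut τ ρ * star (Ut τ ρ) = 1)
    (hmix : ∀ σ τ g ρ, Commute (U σ g) (Ut τ ρ))
    (r : (Δp → PDual G) → (Δp1 → PDual G))
    (hr : ∀ k ∈ Set.range (bd (G := G) s), bd s (r k) = k)
    (t : (Δp1 → G) → (Δp → G))
    (ht : ∀ φ' ∈ Set.range (cb (G := G) s), cb s (t φ') = φ')
    (v : H)
    (hv1 : ∀ φ : Δp → G, cb s φ = 0 → Uop U hU φ v = v)
    (hv2 : ∀ k' : Δp1 → PDual G, bd s k' = 0 → Utop Ut hUt k' v = v) :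
    MC s U hU Ut hUt r v
      = (∑ᶠ φ' ∈ Set.range (cb (G := G) s),
          Ptilde Ut hUt φ' * Uop U hU (t φ')) v := by
  classical
  haveI : Fintype (PDual G) := Fintype.ofFinite _
  set S : H := ∑ φ : Δp → G, ∑ k' : Δp1 → PDual G,
    expA (-(pairing k' (cb s φ))) • Uop U hU φ (Utop Ut hUt k' v) with hS
  have hcomm : ∀ φ k' w, Uop U hU φ (Utop Ut hUt k' w) = Utop Ut hUt k' (Uop U hU φ w) := by
    intro φ k' w
    exact congrArg (fun T : H →L[ℂ] H => T w) (Uop_Utop_comm U hU Ut hUt hmix φ k').eq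
  have hUtr : ∀ k', Utop Ut hUt (r (bd s k')) v = Utop Ut hUt k' v := by
    intro k'
    have h0 : bd s (k' - r (bd s k')) = 0 := by
      have := (bdHom (G := G) s).map_sub k' (r (bd s k'))
      simp only [bdHom, AddMonoidHom.mk'_apply] at this
      rw [this, hr _ ⟨k', rfl⟩, sub_self]
    conv_rhs => rw [← add_sub_cancel (r (bd s k')) k', Utop_add Ut hUt hUthom]
    rw [mul_apply_eq_comp, hv2 _ h0]
  have hUot : ∀ φ, Uop U hU (t (cb s φ)) v = Uop U hU φ v := by
    intro φ
    have h0 : cb s (φ - t (cb s φ)) = 0 := by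
      have := (cbHom (G := G) s).map_sub φ (t (cb s φ))
      simp only [cbHom, AddMonoidHom.mk'_apply] at this
      rw [this, ht _ ⟨φ, rfl⟩, sub_self]
    conv_rhs => rw [← add_sub_cancel (t (cb s φ)) φ, Uop_add U hU hUhom]
    rw [mul_apply_eq_comp, hv1 _ h0]
  have hL : (#{k : Δp1 → PDual G | bd s k = 0} : ℂ) • MC s U hU Ut hUt r v
      = ((Fintype.card G : ℂ) ^ Fintype.card Δp)⁻¹ • S := by
    have := sum_fiber (bdHom (G := G) s) fun k => Pop U hU k * Utop Ut hUt (r k)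
    change ∑ a, (Pop U hU (bd s a) * Utop Ut hUt (r (bd s a))) = #{k : Δp1 → PDual G | bd s k = 0} • MC s U hU Ut hUt r at this
    have := congrArg (fun T : H →L[ℂ] H => T v) this
    rw [Nat.cast_smul_eq_nsmul]
    refine Eq.trans this.symm ?_
    simp only [_root_.sum_apply, mul_apply_eq_comp, hUtr, Pop_eq,
      _root_.smul_apply, pairing_adj]
    rw [← Finset.smul_sum, Finset.sum_comm]
  have hR : (#{φ : Δp → G | cb s φ = 0} : ℂ) • ((∑ᶠ φ' ∈ Set.range (cb (G := G) s),
          Ptilde Ut hUt φ' * Uop U hU (t φ')) v)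
      = ((Fintype.card G : ℂ) ^ Fintype.card Δp1)⁻¹ • S := by
    have := sum_fiber (cbHom (G := G) s) fun φ' => Ptilde Ut hUt φ' * Uop U hU (t φ')
    change ∑ a, (Ptilde Ut hUt (cb s a) * Uop U hU (t (cb s a))) = #{k : Δp → G | cb s k = 0} •
      (∑ᶠ φ' ∈ Set.range (cb (G := G) s), Ptilde Ut hUt φ' * Uop U hU (t φ')) at this
    have := congrArg (fun T : H →L[ℂ] H => T v) this
    rw [Nat.cast_smul_eq_nsmul]
    refine Eq.trans this.symm ?_
    simp only [_root_.sum_apply, mul_apply_eq_comp, hUot, Ptilde,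
      finsum_eq_sum_of_fintype, _root_.smul_apply]
    rw [← Finset.smul_sum, hS]
    simp only [hcomm]
  have hcount := counting (G := G) s
  have hG : (Fintype.card G : ℂ) ≠ 0 := by
    exact_mod_cast Fintype.card_ne_zero
  have hp := pow_ne_zero (Fintype.card Δp) hG
  have hp1 := pow_ne_zero (Fintype.card Δp1) hG
  have hZ : (#{φ : Δp → G | cb s φ = 0} : ℂ) ≠ 0 := by
    have : (0 : Δp → G) ∈ ({φ : Δp → G | cb s φ = 0} : Finset (Δp → G)) := by
      simp [cb, funext_iff]
    exact_mod_cast (Finset.card_pos.mpr ⟨0, this⟩).ne'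
  have hL' : ((Fintype.card G : ℂ) ^ Fintype.card Δp * #{k : Δp1 → PDual G | bd s k = 0}) •
      MC s U hU Ut hUt r v = S := by
    rw [mul_smul, hL, smul_inv_smul₀ hp]
  have hR' : ((Fintype.card G : ℂ) ^ Fintype.card Δp1 * #{φ : Δp → G | cb s φ = 0}) •
      ((∑ᶠ φ' ∈ Set.range (cb (G := G) s), Ptilde Ut hUt φ' * Uop U hU (t φ')) v) = S := by
    rw [mul_smul, hR, smul_inv_smul₀ hp1]
  rw [hcount, ← hR'] at hL'
  exact smul_right_injective H (mul_ne_zero hp1 hZ) hL'
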